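/- arXiv:math/0409287 — 11 statements merged into one kernel-verified Lean document; each statement's English description precedes it below -/
import Mathlib

section
/- For every integer n ≥ 6, the characteristic polynomials of the matrices A_n satisfy the recurrence P_n(λ) = λ² ( P_{n−2}(λ) − P_{n−4}(λ) ), where P_m(λ) = det(A_m − λI) denotes the characteristic polynomial of A_m. -/
/-- The m×m adjacency matrix `A_m` with `(i,j)` entry (1-indexed) equal to 1 iff
`j = i+1` or `i+j = m+1`. -/
def Amat (m : ℕ) : Matrix (Fin m) (Fin m) ℤ :=
  Matrix.of fun i j => if (j.val + 1 = i.val + 2) ∨ (i.val + j.val + 2 = m + 1) then 1 else 0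

/-- `P_m(λ) = det(A_m − λ I)`. -/
noncomputable def Pdet (m : ℕ) : Polynomial ℤ :=
  ((Amat m).map Polynomial.C - (Polynomial.X : Polynomial ℤ) • 1).det

open Polynomial

/-- Entries of `A_m - X`, indexed by natural numbers. -/
noncomputable def gent (m i j : ℕ) : Polynomial ℤ :=
  (if j = i + 1 ∨ i + j + 1 = m then 1 else 0) - (if i = j then X else 0)

lemma gent_zero {m i j : ℕ} (h1 : j ≠ i + 1) (h2 : i + j + 1 ≠ m) (h3 : i ≠ j) :
    gent m i j = 0 := by
  simp [gent, h1, h2, h3]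

/-- The determinant `P_m` through `gent`. -/
noncomputable def Pg (m : ℕ) : Polynomial ℤ :=
  (Matrix.of fun i j : Fin m => gent m i.val j.val).det

/-- The minor of `A_{k+2} - X` without first column and last row. -/
noncomputable def Qg (k : ℕ) : Polynomial ℤ :=
  (Matrix.of fun i j : Fin (k + 1) => gent (k + 2) i.val (j.val + 1)).det

lemma Pdet_eq_Pg (m : ℕ) : Pdet m = Pg m := by
  unfold Pdet Pg
  congr 1
  ext1 i j
  simp only [Amat, gent, Matrix.sub_apply, Matrix.map_apply, Matrix.of_apply, Matrix.smul_apply,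
    Matrix.one_apply, Fin.ext_iff, smul_eq_mul]
  have e : (j.val + 1 = i.val + 2 ∨ i.val + j.val + 2 = m + 1) ↔
    (j.val = i.val + 1 ∨ i.val + j.val + 1 = m) := by omega
  simp only [e]
  split_ifs <;> simp

/-- Expansion along row zero with only two nonzero entries. -/
lemma det_row_two {n : ℕ} (M : Matrix (Fin (n + 2)) (Fin (n + 2)) (Polynomial ℤ))
    (h : ∀ j : Fin n, M 0 j.castSucc.succ = 0) :
    M.det = M 0 0 * (M.submatrix Fin.succ Fin.succ).det
      + (-1) ^ (n + 1) * M 0 (Fin.last _) * (M.submatrix Fin.succ Fin.castSucc).det := by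
  rw [Matrix.det_succ_row_zero, Fin.sum_univ_succ, Fin.sum_univ_castSucc, Finset.sum_eq_zero]
  · have : (Fin.last (n + 1)).succAbove = Fin.castSucc := by
      ext1 x; simp
    simp [this]
  · intro j _
    rw [h]; simp

/-- Expansion along column zero with only two nonzero entries. -/
lemma det_col_two {n : ℕ} (M : Matrix (Fin (n + 2)) (Fin (n + 2)) (Polynomial ℤ))
    (h : ∀ j : Fin n, M j.castSucc.succ 0 = 0) :
    M.det = M 0 0 * (M.submatrix Fin.succ Fin.succ).det
      + (-1) ^ (n + 1) * M (Fin.last _) 0 * (M.submatrix Fin.castSucc Fin.succ).det := by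
  have := det_row_two M.transpose h
  rw [Matrix.det_transpose] at this
  rw [this, ← Matrix.det_transpose (M.submatrix Fin.succ Fin.succ),
    ← Matrix.det_transpose (M.submatrix Fin.castSucc Fin.succ)]
  rfl

/-- Expansion along the last row with only the corner nonzero. -/
lemma det_row_last {n : ℕ} (M : Matrix (Fin (n + 1)) (Fin (n + 1)) (Polynomial ℤ))
    (h : ∀ j : Fin n, M (Fin.last _) j.castSucc = 0) :
    M.det = M (Fin.last _) (Fin.last _) * (M.submatrix Fin.castSucc Fin.castSucc).det := by
  rw [Matrix.det_succ_row M (Fin.last n), Fin.sum_univ_castSucc, Finset.sum_eq_zero]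
  · have : (Fin.last n).succAbove = Fin.castSucc := by
      ext1 x; simp
    simp [this, ← two_mul]
  · intro j _
    rw [h]; simp

lemma det_col_last {n : ℕ} (M : Matrix (Fin (n + 1)) (Fin (n + 1)) (Polynomial ℤ))
    (h : ∀ j : Fin n, M j.castSucc (Fin.last _) = 0) :
    M.det = M (Fin.last _) (Fin.last _) * (M.submatrix Fin.castSucc Fin.castSucc).det := by
  have := det_row_last M.transpose h
  rw [Matrix.det_transpose] at this
  rw [this, ← Matrix.det_transpose (M.submatrix Fin.castSucc Fin.castSucc)]
  rfl

lemma Pg_step (k : ℕ) (hk : 1 ≤ k) :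
    Pg (k + 2) = X ^ 2 * Pg k + (-1) ^ (k + 1) * Qg k := by
  unfold Pg
  rw [det_col_two, det_row_last]
  · have e1 : gent (k + 2) 0 0 = -X := by simp [gent]
    have e2 : gent (k + 2) (k + 1) 0 = 1 := by simp [gent]
    have e3 : gent k k k = -X := by
      have : ¬ (k + k + 1 = k) := by omega
      simp [gent, this]
    have e4 : ∀ i j : ℕ, gent (k + 2) (i + 1) (j + 1) = gent k i j := by
      intro i j
      have h1 : (i + 1 + (j + 1) + 1 = k + 2) ↔ i + j + 1 = k := by omega
      simp only [gent, h1, add_left_inj]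
    simp only [Matrix.submatrix, Matrix.of_apply, Fin.val_zero, Fin.val_succ, Fin.val_last,
      Fin.val_castSucc, e1, e2, e3, e4, Qg]
    ring
  · intro j
    have := j.isLt
    simp only [Matrix.submatrix_apply, Matrix.of_apply, Fin.val_succ, Fin.val_last,
      Fin.val_castSucc]
    exact gent_zero (by omega) (by omega) (by omega)
  · intro j
    have := j.isLt
    simp only [Matrix.of_apply, Fin.val_succ, Fin.val_zero, Fin.val_castSucc]
    exact gent_zero (by omega) (by omega) (by omega)

lemma Qg_step (k : ℕ) : Qg (k + 2) = Qg k + (-1) ^ k * Pg (k + 2) := by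
  rw [Qg, det_row_two, det_col_last]
  · have e1 : gent (k + 2 + 2) 0 (0 + 1) = 1 := by simp [gent]
    have e2 : gent (k + 2 + 2) 0 (k + 1 + 1 + 1) = 1 := by simp [gent]
    have e4 : ∀ i j : ℕ, gent (k + 2 + 2) (i + 1) (j + 1) = gent (k + 2) i j := by
      intro i j
      have h1 : (i + 1 + (j + 1) + 1 = k + 2 + 2) ↔ i + j + 1 = k + 2 := by omega
      simp only [gent, h1, add_left_inj]
    simp only [Matrix.submatrix, Matrix.of_apply, Fin.val_zero, Fin.val_succ, Fin.val_last,
      Fin.val_castSucc, e1, e2, e4, Qg, Pg]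
    have e6 : gent (k + 2) (k + 1) (k + 1 + 1) = 1 := by simp [gent]
    rw [e6]
    ring
  · intro j
    have := j.isLt
    simp only [Matrix.submatrix_apply, Matrix.of_apply, Fin.val_succ, Fin.val_last,
      Fin.val_castSucc]
    exact gent_zero (by omega) (by omega) (by omega)
  · intro j
    have := j.isLt
    simp only [Matrix.of_apply, Fin.val_succ, Fin.val_zero, Fin.val_castSucc]
    exact gent_zero (by omega) (by omega) (by omega)

/-- For `n ≥ 6`, `P_n(λ) = λ² (P_{n−2}(λ) − P_{n−4}(λ))`. -/
theorem stmt3 (n : ℕ) (hn : 6 ≤ n) :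
    Pdet n = Polynomial.X ^ 2 * (Pdet (n - 2) - Pdet (n - 4)) := by
  obtain ⟨k, rfl⟩ : ∃ k, n = k + 4 := ⟨n - 4, by omega⟩
  simp only [Pdet_eq_Pg]
  have a : k + 4 - 2 = k + 2 := by omega
  have b : k + 4 - 4 = k := by omega
  rw [a, b]
  have h1 := Pg_step (k + 2) (by omega)
  have h2 := Pg_step k (by omega)
  rw [Qg_step] at h1
  have s : ((-1 : Polynomial ℤ) ^ k) * (-1) ^ k = 1 := by
    rw [← mul_pow]; simp
  have h3 : (-1 : Polynomial ℤ) ^ (k + 2 + 1) * (Qg k + (-1) ^ k * Pg (k + 2))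
      = (-1) ^ (k + 1) * Qg k - Pg (k + 2) := by
    linear_combination (-Pg (k + 2)) * s
  rw [h3] at h1
  change Pg (k + 2 + 2) = _
  rw [h1]
  linear_combination -h2
end

section
/- For every integer k ≥ 1, the number f_3(k) of meaningful differential operations of k-th order in three-dimensional vector analysis, i.e. the sum of all entries of A_3^{k−1}, equals the Fibonacci number F_{k+3}. -/
/-- The 3×3 adjacency matrix `A_3` with `(i,j)` entry (1-indexed) equal to 1 iff
`j = i+1` or `i+j = 4`. -/
def Amat3 : Matrix (Fin 3) (Fin 3) ℤ :=
  Matrix.of fun i j => if (j.val + 1 = i.val + 2) ∨ (i.val + j.val + 2 = 4) then 1 else 0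

/-- Row sums of the powers of `A_3`. -/
theorem Amat3_row_sums (n : ℕ) :
    (∑ j, (Amat3 ^ n) 0 j = (Nat.fib (n + 2) : ℤ)) ∧
    (∑ j, (Amat3 ^ n) 1 j = (Nat.fib (n + 2) : ℤ)) ∧
    (∑ j, (Amat3 ^ n) 2 j = (Nat.fib (n + 1) : ℤ)) := by
  induction n with
  | zero => simp [Matrix.one_apply]
  | succ n ih =>
    obtain ⟨h0, h1, h2⟩ := ih
    have hf : (Nat.fib (n + 1 + 2) : ℤ) = Nat.fib (n + 1) + Nat.fib (n + 2) := by
      exact_mod_cast Nat.fib_add_two (n := n + 1)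
    have hA : ∀ i j, Amat3 i j =
        if (j.val + 1 = i.val + 2) ∨ (i.val + j.val + 2 = 4) then 1 else 0 := fun _ _ => rfl
    rw [hf]
    simp only [Fin.sum_univ_three] at h0 h1 h2
    simp only [pow_succ', Matrix.mul_apply, Fin.sum_univ_three, hA]
    refine ⟨?_, ?_, ?_⟩ <;> norm_num <;> linarith

/-- For `k ≥ 1`, the sum of all entries of `A_3^(k−1)` equals the Fibonacci number `F_{k+3}`. -/
theorem stmt8 (k : ℕ) (hk : 1 ≤ k) :
    ∑ i, ∑ j, (Amat3 ^ (k - 1)) i j = (Nat.fib (k + 3) : ℤ) := by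
  obtain ⟨n, rfl⟩ : ∃ n, k = n + 1 := ⟨k - 1, by omega⟩
  obtain ⟨h0, h1, h2⟩ := Amat3_row_sums n
  have hf : (Nat.fib (n + 1 + 3) : ℤ) = Nat.fib (n + 2) + Nat.fib (n + 3) := by
    exact_mod_cast Nat.fib_add_two (n := n + 2)
  have hg : (Nat.fib (n + 3) : ℤ) = Nat.fib (n + 1) + Nat.fib (n + 2) := by
    exact_mod_cast Nat.fib_add_two (n := n + 1)
  rw [Fin.sum_univ_three, Nat.add_sub_cancel, h0, h1, h2, hf, hg]
  ring
end

section
/- For every integer p ≥ 1, the (2p)-th power of the 6×6 matrix A_6 is given entrywise by A_6^{2p} = [[F_{2p−1}, 0, F_{2p}, 0, F_{2p}, 0], [0, F_{2p}, 0, F_{2p−1}, 0, F_{2p}], [F_{2p−2}, 0, F_{2p−1}, 0, F_{2p−1}, 0], [0, F_{2p}, 0, F_{2p−1}, 0, F_{2p}], [F_{2p−1}, 0, F_{2p}, 0, F_{2p}, 0], [0, F_{2p−1}, 0, F_{2p−2}, 0, F_{2p−1}]], where F_m denotes the m-th Fibonacci number. -/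
/-- The 6×6 adjacency matrix `A_6` with `(i,j)` entry (1-indexed) equal to 1 iff
`j = i+1` or `i+j = 7`. -/
def Amat6 : Matrix (Fin 6) (Fin 6) ℤ :=
  Matrix.of fun i j => if (j.val + 1 = i.val + 2) ∨ (i.val + j.val + 2 = 7) then 1 else 0

/-- Explicit form of the even powers `A_6^{2p}`, `p ≥ 1`, via Fibonacci numbers. -/
theorem stmt10 (p : ℕ) (hp : 1 ≤ p) :
    Amat6 ^ (2 * p) =
      !![(Nat.fib (2 * p - 1) : ℤ), 0, (Nat.fib (2 * p) : ℤ), 0, (Nat.fib (2 * p) : ℤ), 0;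
         0, (Nat.fib (2 * p) : ℤ), 0, (Nat.fib (2 * p - 1) : ℤ), 0, (Nat.fib (2 * p) : ℤ);
         (Nat.fib (2 * p - 2) : ℤ), 0, (Nat.fib (2 * p - 1) : ℤ), 0, (Nat.fib (2 * p - 1) : ℤ), 0;
         0, (Nat.fib (2 * p) : ℤ), 0, (Nat.fib (2 * p - 1) : ℤ), 0, (Nat.fib (2 * p) : ℤ);
         (Nat.fib (2 * p - 1) : ℤ), 0, (Nat.fib (2 * p) : ℤ), 0, (Nat.fib (2 * p) : ℤ), 0;
         0, (Nat.fib (2 * p - 1) : ℤ), 0, (Nat.fib (2 * p - 2) : ℤ), 0, (Nat.fib (2 * p - 1) : ℤ)] := by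
  have h2 : Amat6 ^ 2 =
      !![1, 0, 1, 0, 1, 0; 0, 1, 0, 1, 0, 1; 0, 0, 1, 0, 1, 0;
         0, 1, 0, 1, 0, 1; 1, 0, 1, 0, 1, 0; 0, 1, 0, 0, 0, 1] := by
    rw [pow_two]
    decide
  induction p, hp using Nat.le_induction with
  | base => simpa using h2
  | succ n hn ih =>
    obtain ⟨k, rfl⟩ : ∃ k, n = k + 1 := ⟨n - 1, by omega⟩
    have e1 : 2 * (k + 1) - 1 = 2 * k + 1 := by omega
    have e2 : 2 * (k + 1) - 2 = 2 * k := by omega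
    have e3 : 2 * (k + 1) = 2 * k + 2 := by omega
    have e4 : 2 * (k + 1 + 1) - 1 = 2 * k + 3 := by omega
    have e5 : 2 * (k + 1 + 1) - 2 = 2 * k + 2 := by omega
    have e6 : 2 * (k + 1 + 1) = 2 * k + 4 := by omega
    have f2 : Nat.fib (2 * k + 2) = Nat.fib (2 * k) + Nat.fib (2 * k + 1) := Nat.fib_add_two
    have f3 : Nat.fib (2 * k + 3) = Nat.fib (2 * k + 1) + Nat.fib (2 * k + 2) := Nat.fib_add_two
    have f4 : Nat.fib (2 * k + 4) = Nat.fib (2 * k + 2) + Nat.fib (2 * k + 3) := Nat.fib_add_two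
    have hs : Amat6 ^ (2 * (k + 1 + 1)) = Amat6 ^ (2 * (k + 1)) * Amat6 ^ 2 := by
      rw [← pow_add]
      rfl
    rw [hs, ih, h2, e1, e2, e3, e4, e5, e6, f4, f3, f2]
    push_cast
    generalize (Nat.fib (2 * k) : ℤ) = a
    generalize (Nat.fib (2 * k + 1) : ℤ) = b
    ext i j
    fin_cases i <;> fin_cases j <;>
      simp [Matrix.mul_apply, Fin.sum_univ_succ] <;> ring
end

section
/- For every integer p ≥ 1, the (2p+1)-th power of the 6×6 matrix A_6 is given entrywise by A_6^{2p+1} = [[0, F_{2p+1}, 0, F_{2p}, 0, F_{2p+1}], [F_{2p}, 0, F_{2p+1}, 0, F_{2p+1}, 0], [0, F_{2p}, 0, F_{2p−1}, 0, F_{2p}], [F_{2p}, 0, F_{2p+1}, 0, F_{2p+1}, 0], [0, F_{2p+1}, 0, F_{2p}, 0, F_{2p+1}], [F_{2p−1}, 0, F_{2p}, 0, F_{2p}, 0]], where F_m denotes the m-th Fibonacci number. -/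
set_option maxHeartbeats 1000000 in
/-- Explicit form of the odd powers `A_6^{2p+1}`, `p ≥ 1`, via Fibonacci numbers. -/
theorem stmt11 (p : ℕ) (hp : 1 ≤ p) :
    Amat6 ^ (2 * p + 1) =
      !![0, (Nat.fib (2 * p + 1) : ℤ), 0, (Nat.fib (2 * p) : ℤ), 0, (Nat.fib (2 * p + 1) : ℤ);
         (Nat.fib (2 * p) : ℤ), 0, (Nat.fib (2 * p + 1) : ℤ), 0, (Nat.fib (2 * p + 1) : ℤ), 0;
         0, (Nat.fib (2 * p) : ℤ), 0, (Nat.fib (2 * p - 1) : ℤ), 0, (Nat.fib (2 * p) : ℤ);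
         (Nat.fib (2 * p) : ℤ), 0, (Nat.fib (2 * p + 1) : ℤ), 0, (Nat.fib (2 * p + 1) : ℤ), 0;
         0, (Nat.fib (2 * p + 1) : ℤ), 0, (Nat.fib (2 * p) : ℤ), 0, (Nat.fib (2 * p + 1) : ℤ);
         (Nat.fib (2 * p - 1) : ℤ), 0, (Nat.fib (2 * p) : ℤ), 0, (Nat.fib (2 * p) : ℤ), 0] := by
  induction p, hp using Nat.le_induction with
  | base => decide +kernel
  | succ n hn ih =>
    obtain ⟨k, rfl⟩ : ∃ k, n = k + 1 := ⟨n - 1, by omega⟩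
    have e : 2 * (k + 1 + 1) + 1 = (2 * (k + 1) + 1) + 2 := by ring
    have hA : Amat6 ^ 2 = Amat6 * Amat6 := sq _
    have h1 : 2 * (k + 1) - 1 = 2 * k + 1 := by omega
    have h2 : 2 * (k + 1) = 2 * k + 2 := by omega
    have h3 : 2 * (k + 1 + 1) - 1 = 2 * k + 3 := by omega
    have h4 : 2 * (k + 1 + 1) = 2 * k + 4 := by omega
    have f3 : (Nat.fib (2 * k + 3) : ℤ) = Nat.fib (2 * k + 1) + Nat.fib (2 * k + 2) := by
      exact_mod_cast Nat.fib_add_two (n := 2 * k + 1)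
    have f4 : (Nat.fib (2 * k + 4) : ℤ) = Nat.fib (2 * k + 2) + Nat.fib (2 * k + 3) := by
      exact_mod_cast Nat.fib_add_two (n := 2 * k + 2)
    have f5 : (Nat.fib (2 * k + 5) : ℤ) = Nat.fib (2 * k + 3) + Nat.fib (2 * k + 4) := by
      exact_mod_cast Nat.fib_add_two (n := 2 * k + 3)
    rw [e, pow_add, ih, hA, h1, h3, h4, h2]
    rw [show 2 * k + 2 + 1 = 2 * k + 3 from rfl, show 2 * k + 4 + 1 = 2 * k + 5 from rfl, f5, f4, f3]
    generalize (Nat.fib (2 * k + 1) : ℤ) = a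
    generalize (Nat.fib (2 * k + 2) : ℤ) = b
    ext i j
    fin_cases i <;> fin_cases j <;>
      simp [Amat6, Matrix.mul_apply, Fin.sum_univ_succ] <;> ring
end

section
/- For every integer k ≥ 1, the number f_6(k) of meaningful differential operations of k-th order in six-dimensional vector analysis, i.e. the sum of all entries of A_6^{k−1}, equals 2·F_{k+3}, twice the Fibonacci number of index k+3. -/
theorem Amat6_row_sums (n : ℕ) (i : Fin 6) : ∑ j, (Amat6 ^ n) i j =
    if i = 2 ∨ i = 5 then (Nat.fib (n + 1) : ℤ) else (Nat.fib (n + 2) : ℤ) := by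
  induction n generalizing i with
  | zero => fin_cases i <;> simp [Fin.sum_univ_six, Matrix.one_apply]
  | succ n ih =>
    have h : ∑ j, (Amat6 ^ (n + 1)) i j = ∑ l, Amat6 i l * ∑ j, (Amat6 ^ n) l j := by
      simp only [pow_succ', Matrix.mul_apply, Finset.mul_sum]
      exact Finset.sum_comm
    rw [h]
    simp only [ih]
    have h3 : (Nat.fib (n + 3) : ℤ) = Nat.fib (n + 1) + Nat.fib (n + 2) := by
      exact_mod_cast Nat.fib_add_two (n := n + 1)
    fin_cases i <;> simp [Fin.sum_univ_six, Amat6, Fin.ext_iff, h3, add_assoc] <;> ring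

/-- For `k ≥ 1`, the sum of all entries of `A_6^(k−1)` equals `2 F_{k+3}`. -/
theorem stmt12 (k : ℕ) (hk : 1 ≤ k) :
    ∑ i, ∑ j, (Amat6 ^ (k - 1)) i j = 2 * (Nat.fib (k + 3) : ℤ) := by
  obtain ⟨n, rfl⟩ : ∃ n, k = n + 1 := ⟨k - 1, by omega⟩
  have h3 : (Nat.fib (n + 3) : ℤ) = Nat.fib (n + 1) + Nat.fib (n + 2) := by
    exact_mod_cast Nat.fib_add_two (n := n + 1)
  have h4 : (Nat.fib (n + 1 + 3) : ℤ) = Nat.fib (n + 2) + Nat.fib (n + 3) := by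
    exact_mod_cast Nat.fib_add_two (n := n + 2)
  simp only [Nat.add_sub_cancel, Amat6_row_sums]
  rw [h4, h3]
  simp [Fin.sum_univ_six, Fin.ext_iff]
  ring
end

section
/- For every integer i ≥ 1, the number f_4 of meaningful differential operations of higher order in four-dimensional vector analysis satisfies the recurrence f_4(i+2) = 2·f_4(i), where f_4(k) denotes the sum of all entries of A_4^{k−1}. -/
/-- The 4×4 adjacency matrix `A_4` with `(i,j)` entry (1-indexed) equal to 1 iff
`j = i+1` or `i+j = 5`. -/
def Amat4 : Matrix (Fin 4) (Fin 4) ℤ :=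
  Matrix.of fun i j => if (j.val + 1 = i.val + 2) ∨ (i.val + j.val + 2 = 5) then 1 else 0

/-- Recurrence for the number `f k` of meaningful differential operations of k-th order
in 4-dimensional vector analysis, where `f k` is the sum of all entries of `A_4^(k−1)`. -/
theorem stmt13 (f : ℕ → ℤ)
    (hf : ∀ k, 1 ≤ k → f k = ∑ i, ∑ j, (Amat4 ^ (k - 1)) i j)
    (i : ℕ) (hi : 1 ≤ i) :
    f (i + 2) = 2 * f i := by
  obtain ⟨n, rfl⟩ : ∃ n, i = n + 1 := ⟨i - 1, by omega⟩
  rw [hf _ (by omega), hf _ hi]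
  have h1 : n + 1 + 2 - 1 = n + 2 := by omega
  have h2 : n + 1 - 1 = n := by omega
  have hs : ∀ l, ∑ j, (Amat4 ^ 2) l j = 2 := by decide
  rw [h1, h2, pow_add, Finset.mul_sum]
  refine Finset.sum_congr rfl fun r _ => ?_
  simp only [Matrix.mul_apply]
  rw [Finset.sum_comm, Finset.mul_sum]
  refine Finset.sum_congr rfl fun l _ => ?_
  rw [← Finset.mul_sum, hs, mul_comm]
end

section
/- For every integer i ≥ 1, the number f_5 of meaningful differential operations of higher order in five-dimensional vector analysis satisfies the recurrence f_5(i+3) = f_5(i+2) + 2·f_5(i+1) − f_5(i), where f_5(k) denotes the sum of all entries of A_5^{k−1}. -/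
/-- The 5×5 adjacency matrix `A_5` with `(i,j)` entry (1-indexed) equal to 1 iff
`j = i+1` or `i+j = 6`. -/
def Amat5 : Matrix (Fin 5) (Fin 5) ℤ :=
  Matrix.of fun i j => if (j.val + 1 = i.val + 2) ∨ (i.val + j.val + 2 = 6) then 1 else 0


theorem Amat5_vec :
    (Amat5 ^ 3).mulVec 1 = (Amat5 ^ 2).mulVec 1 + 2 • (Amat5 ^ 1).mulVec 1 - (1 : Fin 5 → ℤ) := by
  simp only [pow_succ, pow_zero, one_mul]
  simp only [← Matrix.mulVec_mulVec]
  decide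

theorem Amat5_sum (M : Matrix (Fin 5) (Fin 5) ℤ) :
    ∑ i, ∑ j, M i j = ∑ i, M.mulVec 1 i := by
  simp [Matrix.mulVec, dotProduct]

/-- Recurrence for the number `f k` of meaningful differential operations of k-th order
in 5-dimensional vector analysis, where `f k` is the sum of all entries of `A_5^(k−1)`. -/
theorem stmt14 (f : ℕ → ℤ)
    (hf : ∀ k, 1 ≤ k → f k = ∑ i, ∑ j, (Amat5 ^ (k - 1)) i j)
    (i : ℕ) (hi : 1 ≤ i) :
    f (i + 3) = f (i + 2) + 2 * f (i + 1) - f i := by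
  obtain ⟨n, rfl⟩ : ∃ n, i = n + 1 := ⟨i - 1, by omega⟩
  rw [hf _ (by omega), hf _ (by omega), hf _ (by omega), hf _ (by omega)]
  simp only [Amat5_sum]
  rw [show n + 1 + 3 - 1 = n + 3 by omega, show n + 1 + 2 - 1 = n + 2 by omega,
    show n + 1 + 1 - 1 = n + 1 by omega, show n + 1 - 1 = n by omega]
  have h : (Amat5 ^ (n + 3)).mulVec 1 = (Amat5 ^ (n + 2)).mulVec 1
      + 2 • (Amat5 ^ (n + 1)).mulVec 1 - (Amat5 ^ n).mulVec (1 : Fin 5 → ℤ) := by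
    rw [pow_add, pow_add, pow_add Amat5 n 1, ← Matrix.mulVec_mulVec, ← Matrix.mulVec_mulVec,
      ← Matrix.mulVec_mulVec, Amat5_vec, Matrix.mulVec_sub, Matrix.mulVec_add, Matrix.mulVec_smul]
  rw [h]
  simp [Finset.sum_add_distrib, Finset.mul_sum]
end

section
/- For every integer i ≥ 1, the number f_6 of meaningful differential operations of higher order in six-dimensional vector analysis satisfies the recurrence f_6(i+4) = 3·f_6(i+2) − f_6(i), where f_6(k) denotes the sum of all entries of A_6^{k−1}. -/
/-- The all-ones vector `u` satisfies `A² u = A u + u`. -/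
lemma amat6_sq_one :
    (Amat6 * Amat6).mulVec (fun _ => (1 : ℤ)) = Amat6.mulVec (fun _ => 1) + fun _ => 1 := by
  decide +kernel

/-- Hence the entry sums satisfy the Fibonacci recurrence. -/
lemma amat6_fib (m : ℕ) :
    ∑ i, ∑ j, (Amat6 ^ (m + 2)) i j
      = ∑ i, ∑ j, (Amat6 ^ (m + 1)) i j + ∑ i, ∑ j, (Amat6 ^ m) i j := by
  have key : ∀ M : Matrix (Fin 6) (Fin 6) ℤ,
      ∑ i, ∑ j, M i j = ∑ i, M.mulVec (fun _ => (1 : ℤ)) i := by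
    intro M
    simp [Matrix.mulVec, dotProduct]
  have h : (Amat6 ^ (m + 2)).mulVec (fun _ => (1 : ℤ))
      = (Amat6 ^ (m + 1)).mulVec (fun _ => 1) + (Amat6 ^ m).mulVec (fun _ => 1) := by
    rw [pow_add, pow_two, ← Matrix.mulVec_mulVec, amat6_sq_one, Matrix.mulVec_add,
      Matrix.mulVec_mulVec, ← pow_succ]
  rw [key, key, key, h, ← Finset.sum_add_distrib]
  rfl

/-- Recurrence for the number `f k` of meaningful differential operations of k-th order
in 6-dimensional vector analysis, where `f k` is the sum of all entries of `A_6^(k−1)`. -/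
theorem stmt15 (f : ℕ → ℤ)
    (hf : ∀ k, 1 ≤ k → f k = ∑ i, ∑ j, (Amat6 ^ (k - 1)) i j)
    (i : ℕ) (hi : 1 ≤ i) :
    f (i + 4) = 3 * f (i + 2) - f i := by
  obtain ⟨m, rfl⟩ : ∃ m, i = m + 1 := ⟨i - 1, by omega⟩
  have e0 := hf (m + 1) (by omega)
  have e2 := hf (m + 1 + 2) (by omega)
  have e4 := hf (m + 1 + 4) (by omega)
  rw [show m + 1 - 1 = m by omega] at e0
  rw [show m + 1 + 2 - 1 = m + 2 by omega] at e2
  rw [show m + 1 + 4 - 1 = m + 4 by omega] at e4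
  have h0 := amat6_fib m
  have h1 := amat6_fib (m + 1)
  have h2 := amat6_fib (m + 2)
  simp only [add_assoc, Nat.reduceAdd] at h0 h1 h2
  rw [e0, e2, e4]
  linarith
end

section
/- For every integer i ≥ 1, the number f_8 of meaningful differential operations of higher order in eight-dimensional vector analysis satisfies the recurrence f_8(i+4) = 4·f_8(i+2) − 3·f_8(i), where f_8(k) denotes the sum of all entries of A_8^{k−1}. -/
/-- The 8×8 adjacency matrix `A_8` with `(i,j)` entry (1-indexed) equal to 1 iff
`j = i+1` or `i+j = 9`. -/
def Amat8 : Matrix (Fin 8) (Fin 8) ℤ :=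
  Matrix.of fun i j => if (j.val + 1 = i.val + 2) ∨ (i.val + j.val + 2 = 9) then 1 else 0

open Matrix in
theorem key8 : (Amat8 * (Amat8 * (Amat8 * (Amat8 * Amat8)))) *ᵥ (1 : Fin 8 → ℤ)
    = (4 : ℤ) • ((Amat8 * (Amat8 * Amat8)) *ᵥ 1) - (3 : ℤ) • (Amat8 *ᵥ 1) := by
  simp only [← Matrix.mulVec_mulVec]
  have h1 : Amat8 *ᵥ (1 : Fin 8 → ℤ) = ![2, 2, 2, 1, 2, 2, 2, 1] := by decide
  have h2 : Amat8 *ᵥ ![2, 2, 2, 1, 2, 2, 2, 1] = ![3, 4, 3, 2, 3, 4, 3, 2] := by decide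
  have h3 : Amat8 *ᵥ ![3, 4, 3, 2, 3, 4, 3, 2] = ![6, 6, 6, 3, 6, 6, 6, 3] := by decide
  have h4 : Amat8 *ᵥ ![6, 6, 6, 3, 6, 6, 6, 3] = ![9, 12, 9, 6, 9, 12, 9, 6] := by decide
  have h5 : Amat8 *ᵥ ![9, 12, 9, 6, 9, 12, 9, 6] = ![18, 18, 18, 9, 18, 18, 18, 9] := by decide
  rw [h1, h2, h3, h4, h5]
  decide

open Matrix in
theorem sum8 (M : Matrix (Fin 8) (Fin 8) ℤ) :
    ∑ i, ∑ j, M i j = (1 : Fin 8 → ℤ) ⬝ᵥ (M *ᵥ 1) := by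
  simp [dotProduct, mulVec]

/-- Recurrence for the number `f k` of meaningful differential operations of k-th order
in 8-dimensional vector analysis, where `f k` is the sum of all entries of `A_8^(k−1)`. -/
theorem stmt17 (f : ℕ → ℤ)
    (hf : ∀ k, 1 ≤ k → f k = ∑ i, ∑ j, (Amat8 ^ (k - 1)) i j)
    (i : ℕ) (hi : 1 ≤ i) :
    f (i + 4) = 4 * f (i + 2) - 3 * f i := by
  obtain ⟨n, rfl⟩ : ∃ n, i = n + 1 := ⟨i - 1, by omega⟩
  rw [hf _ (by omega), hf _ (by omega), hf _ (by omega)]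
  simp only [sum8]
  have e1 : n + 1 + 4 - 1 = n + 4 := by omega
  have e2 : n + 1 + 2 - 1 = n + 2 := by omega
  have e3 : n + 1 - 1 = n := by omega
  rw [e1, e2, e3]
  rcases n with _ | m
  · simp only [zero_add, pow_succ', pow_zero, mul_one, ← Matrix.mulVec_mulVec, Matrix.one_mulVec]
    decide
  · have a1 : Amat8 ^ (m + 1 + 4) = Amat8 ^ m * (Amat8 * (Amat8 * (Amat8 * (Amat8 * Amat8)))) := by
      simp only [pow_succ, mul_assoc]
    have a2 : Amat8 ^ (m + 1 + 2) = Amat8 ^ m * (Amat8 * (Amat8 * Amat8)) := by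
      simp only [pow_succ, mul_assoc]
    rw [a1, a2, pow_succ, ← Matrix.mulVec_mulVec, key8]
    simp only [Matrix.mulVec_sub, Matrix.mulVec_smul, dotProduct_sub, dotProduct_smul,
      Matrix.mulVec_mulVec, smul_eq_mul]
end

section
/- For every integer i ≥ 1, the number f_9 of meaningful differential operations of higher order in nine-dimensional vector analysis satisfies the recurrence f_9(i+5) = f_9(i+4) + 4·f_9(i+3) − 3·f_9(i+2) − 3·f_9(i+1) + f_9(i), where f_9(k) denotes the sum of all entries of A_9^{k−1}. -/
/-- The 9×9 adjacency matrix `A_9` with `(i,j)` entry (1-indexed) equal to 1 iff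
`j = i+1` or `i+j = 10`. -/
def Amat9 : Matrix (Fin 9) (Fin 9) ℤ :=
  Matrix.of fun i j => if (j.val + 1 = i.val + 2) ∨ (i.val + j.val + 2 = 10) then 1 else 0

open Matrix in
lemma Amat9_step0 : Amat9 *ᵥ (![1, 1, 1, 1, 1, 1, 1, 1, 1] : Fin 9 → ℤ) = ![2, 2, 2, 2, 2, 2, 2, 2, 1] := by
  decide +kernel

open Matrix in
lemma Amat9_step1 : Amat9 *ᵥ (![2, 2, 2, 2, 2, 2, 2, 2, 1] : Fin 9 → ℤ) = ![3, 4, 4, 4, 4, 4, 4, 3, 2] := by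
  decide +kernel

open Matrix in
lemma Amat9_step2 : Amat9 *ᵥ (![3, 4, 4, 4, 4, 4, 4, 3, 2] : Fin 9 → ℤ) = ![6, 7, 8, 8, 8, 8, 7, 6, 3] := by
  decide +kernel

open Matrix in
lemma Amat9_step3 : Amat9 *ᵥ (![6, 7, 8, 8, 8, 8, 7, 6, 3] : Fin 9 → ℤ) = ![10, 14, 15, 16, 16, 15, 14, 10, 6] := by
  decide +kernel

open Matrix in
lemma Amat9_step4 : Amat9 *ᵥ (![10, 14, 15, 16, 16, 15, 14, 10, 6] : Fin 9 → ℤ) = ![20, 25, 30, 31, 31, 30, 25, 20, 10] := by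
  decide +kernel

open Matrix in
lemma Amat9_sum (M : Matrix (Fin 9) (Fin 9) ℤ) :
    ∑ i, ∑ j, M i j = ∑ i, (M *ᵥ (![1, 1, 1, 1, 1, 1, 1, 1, 1] : Fin 9 → ℤ)) i := by
  have h : (![1, 1, 1, 1, 1, 1, 1, 1, 1] : Fin 9 → ℤ) = fun _ => 1 := by decide
  rw [h]
  simp [Matrix.mulVec, dotProduct]

/-- Recurrence for the number `f k` of meaningful differential operations of k-th order
in 9-dimensional vector analysis, where `f k` is the sum of all entries of `A_9^(k−1)`. -/
theorem stmt18 (f : ℕ → ℤ)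
    (hf : ∀ k, 1 ≤ k → f k = ∑ i, ∑ j, (Amat9 ^ (k - 1)) i j)
    (i : ℕ) (hi : 1 ≤ i) :
    f (i + 5) = f (i + 4) + 4 * f (i + 3) - 3 * f (i + 2) - 3 * f (i + 1) + f i := by
  obtain ⟨n, rfl⟩ : ∃ n, i = n + 1 := ⟨i - 1, by omega⟩
  rw [hf (n + 1 + 5) (by omega), hf (n + 1 + 4) (by omega), hf (n + 1 + 3) (by omega),
    hf (n + 1 + 2) (by omega), hf (n + 1 + 1) (by omega), hf (n + 1) (by omega)]
  have e : ∀ m, n + 1 + m - 1 = n + m := fun m => by omega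
  simp only [e, Nat.add_sub_cancel, Amat9_sum]
  simp only [pow_succ, ← Matrix.mulVec_mulVec, Amat9_step0, Amat9_step1, Amat9_step2,
    Amat9_step3, Amat9_step4]
  simp only [Matrix.mulVec, dotProduct, Finset.mul_sum, ← Finset.sum_add_distrib,
    ← Finset.sum_sub_distrib]
  refine Finset.sum_congr rfl fun a _ => ?_
  refine Finset.sum_congr rfl fun b _ => ?_
  fin_cases b <;> simp <;> ring
end

section
/- For every integer i ≥ 1, the number f_10 of meaningful differential operations of higher order in ten-dimensional vector analysis satisfies the recurrence f_10(i+6) = 5·f_10(i+4) − 6·f_10(i+2) + f_10(i), where f_10(k) denotes the sum of all entries of A_10^{k−1}. -/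
/-- The 10×10 adjacency matrix `A_10` with `(i,j)` entry (1-indexed) equal to 1 iff
`j = i+1` or `i+j = 11`. -/
def Amat10 : Matrix (Fin 10) (Fin 10) ℤ :=
  Matrix.of fun i j => if (j.val + 1 = i.val + 2) ∨ (i.val + j.val + 2 = 11) then 1 else 0

/-- One-vector identity `A^6 1 = 5 A^4 1 - 6 A^2 1 + 1`. -/
theorem key_vec :
    (Amat10 ^ 6).mulVec 1 = (5 : ℤ) • (Amat10 ^ 4).mulVec 1 - (6 : ℤ) • (Amat10 ^ 2).mulVec 1
      + (1 : Fin 10 → ℤ) := by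
  have h1 : Amat10.mulVec 1 = ![2, 2, 2, 2, 1, 2, 2, 2, 2, 1] := by decide +kernel
  have h2 : Amat10.mulVec ![2, 2, 2, 2, 1, 2, 2, 2, 2, 1] = ![3, 4, 4, 3, 2, 3, 4, 4, 3, 2] := by
    decide +kernel
  have h3 : Amat10.mulVec ![3, 4, 4, 3, 2, 3, 4, 4, 3, 2] = ![6, 7, 7, 6, 3, 6, 7, 7, 6, 3] := by
    decide +kernel
  have h4 : Amat10.mulVec ![6, 7, 7, 6, 3, 6, 7, 7, 6, 3]
      = ![10, 13, 13, 10, 6, 10, 13, 13, 10, 6] := by decide +kernel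
  have h5 : Amat10.mulVec ![10, 13, 13, 10, 6, 10, 13, 13, 10, 6]
      = ![19, 23, 23, 19, 10, 19, 23, 23, 19, 10] := by decide +kernel
  have h6 : Amat10.mulVec ![19, 23, 23, 19, 10, 19, 23, 23, 19, 10]
      = ![33, 42, 42, 33, 19, 33, 42, 42, 33, 19] := by decide +kernel
  simp only [pow_succ, pow_zero, one_mul, ← Matrix.mulVec_mulVec, h1, h2, h3, h4, h5, h6]
  decide +kernel

theorem sum_entries (k : ℕ) (M : Matrix (Fin 10) (Fin 10) ℤ) :
    ∑ i, ∑ j, (Amat10 ^ k * M) i j = ∑ i, (Amat10 ^ k).mulVec (M.mulVec 1) i := by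
  rw [Matrix.mulVec_mulVec]
  simp [Matrix.mulVec, dotProduct]

/-- Recurrence for the number `f k` of meaningful differential operations of k-th order
in 10-dimensional vector analysis, where `f k` is the sum of all entries of `A_10^(k−1)`. -/
theorem stmt19 (f : ℕ → ℤ)
    (hf : ∀ k, 1 ≤ k → f k = ∑ i, ∑ j, (Amat10 ^ (k - 1)) i j)
    (i : ℕ) (hi : 1 ≤ i) :
    f (i + 6) = 5 * f (i + 4) - 6 * f (i + 2) + f i := by
  obtain ⟨m, rfl⟩ : ∃ m, i = m + 1 := ⟨i - 1, by omega⟩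
  have key : ∀ d, f (m + 1 + d) = ∑ i, (Amat10 ^ m).mulVec ((Amat10 ^ d).mulVec 1) i := by
    intro d
    rw [hf _ (by omega), show m + 1 + d - 1 = m + d by omega, pow_add, sum_entries]
  have h0 := key 0
  rw [pow_zero, Matrix.one_mulVec, add_zero] at h0
  rw [key 6, key 4, key 2, h0, key_vec, Matrix.mulVec_add, Matrix.mulVec_sub,
    Matrix.mulVec_smul, Matrix.mulVec_smul]
  simp only [Pi.add_apply, Pi.sub_apply, Pi.smul_apply, smul_eq_mul, Finset.sum_add_distrib,
    Finset.sum_sub_distrib, Finset.mul_sum]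
end
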